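/- arXiv:1909.05270 — 11 statements merged into one kernel-verified Lean document; each statement's English description precedes it below -/
import Mathlib

section
/- Non-commuting gates never change their relative order: if the labels i j : Fin n satisfy i < j and ¬ Commute (c i) (c j), then every admissible reordering σ of the circuit c : Fin n → M satisfies σ⁻¹ i < σ⁻¹ j. -/
/-- One step of interchanging two adjacent commuting gates. -/
def Step {M : Type*} [Monoid M] {n : ℕ} (c : Fin n → M)
    (σ σ' : Equiv.Perm (Fin n)) : Prop :=
  ∃ k k' : Fin n, (k' : ℕ) = (k : ℕ) + 1 ∧ σ' = σ * Equiv.swap k k' ∧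
    Commute (c (σ k)) (c (σ k'))

/-- σ is an admissible reordering of the circuit c. -/
def Admissible {M : Type*} [Monoid M] {n : ℕ} (c : Fin n → M)
    (σ : Equiv.Perm (Fin n)) : Prop :=
  Relation.ReflTransGen (Step c) 1 σ

/-- The dependence relation of a circuit. -/
def Dep {M : Type*} [Monoid M] {n : ℕ} (c : Fin n → M) (i j : Fin n) : Prop :=
  i < j ∧ ¬ Commute (c i) (c j)

/-- The edge relation of the canonical form of a circuit. -/
def CanonEdge {M : Type*} [Monoid M] {n : ℕ} (c : Fin n → M) (i j : Fin n) : Prop :=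
  ¬ Commute (c i) (c j) ∧
    ∃ σ : Equiv.Perm (Fin n), Admissible c σ ∧ ((σ⁻¹ j : Fin n) : ℕ) = ((σ⁻¹ i : Fin n) : ℕ) + 1

/-- Swapping two adjacent positions preserves the order of every other pair of positions. -/
theorem swap_lt_swap_of_adjacent {n : ℕ} {k k' a b : Fin n} (hk : (k' : ℕ) = (k : ℕ) + 1)
    (hab : a < b) (hne : ¬ (a = k ∧ b = k')) :
    Equiv.swap k k' a < Equiv.swap k k' b := by
  simp only [Equiv.swap_apply_def]
  split_ifs <;> simp only [Fin.ext_iff, Fin.lt_def] at * <;> omega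

/-- A single step preserves the relative order of two non-commuting gates. -/
theorem Step.inv_lt_inv {M : Type*} [Monoid M] {n : ℕ} {c : Fin n → M}
    {σ σ' : Equiv.Perm (Fin n)} (h : Step c σ σ') {i j : Fin n}
    (hnc : ¬ Commute (c i) (c j)) (hlt : σ⁻¹ i < σ⁻¹ j) : σ'⁻¹ i < σ'⁻¹ j := by
  obtain ⟨k, k', hk, rfl, hcomm⟩ := h
  rw [mul_inv_rev, Equiv.swap_inv, Equiv.Perm.mul_apply, Equiv.Perm.mul_apply]
  refine swap_lt_swap_of_adjacent hk hlt ?_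
  rintro ⟨rfl, rfl⟩
  exact hnc (by simpa using hcomm)

theorem noncommuting_gates_keep_order {M : Type*} [Monoid M] {n : ℕ}
    (c : Fin n → M) (i j : Fin n) (hij : i < j)
    (hnc : ¬ Commute (c i) (c j))
    (σ : Equiv.Perm (Fin n)) (hσ : Admissible c σ) :
    σ⁻¹ i < σ⁻¹ j := by
  induction hσ with
  | refl => simpa using hij
  | tail _ hstep ih => exact hstep.inv_lt_inv hnc ih
end

section
/- Necessary and sufficient condition for interchanging gates (Lemma 2.2): for a circuit c : Fin n → M and labels i j : Fin n with i < j, the following are equivalent: (1) there exists an admissible reordering σ of c with σ⁻¹ j < σ⁻¹ i, i.e. the order of gates i and j can be interchanged by pairwise commuting gates in the circuit; (2) j is not a successor of i in the canonical form of c, i.e. ¬ Relation.TransGen (CanonEdge c) i j. -/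
section Circuit

variable {M : Type*} [Monoid M] {n : ℕ} {c : Fin n → M}

/-- Admissible reorderings preserve the relative order of dependent gates. -/
theorem Admissible.inv_lt_of_dep {σ : Equiv.Perm (Fin n)} (hσ : Admissible c σ)
    {i j : Fin n} (h : Dep c i j) : σ⁻¹ i < σ⁻¹ j := by
  induction hσ with
  | refl => simpa using h.1
  | @tail τ σ _ hstep ih =>
    obtain ⟨k, k', hk, rfl, hcomm⟩ := hstep
    obtain ⟨p, rfl⟩ := τ.surjective i
    obtain ⟨q, rfl⟩ := τ.surjective j
    have hn : ¬ (p = k ∧ q = k') := by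
      rintro ⟨rfl, rfl⟩
      exact h.2 hcomm
    simp only [mul_inv_rev, Equiv.swap_inv, Equiv.Perm.mul_apply, Equiv.Perm.coe_inv,
      Equiv.symm_apply_apply, Equiv.swap_apply_def] at ih ⊢
    split_ifs <;> simp only [Fin.lt_def, Fin.ext_iff] at * <;> omega

theorem CanonEdge.dep {i j : Fin n} (h : CanonEdge c i j) : Dep c i j := by
  obtain ⟨hc, σ, hσ, hpos⟩ := h
  refine ⟨?_, hc⟩
  rcases lt_trichotomy i j with hij | rfl | hji
  · exact hij
  · exact absurd (Commute.refl _) hc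
  · have hlt := hσ.inv_lt_of_dep ⟨hji, fun h => hc h.symm⟩
    rw [Fin.lt_def] at hlt
    omega

theorem Admissible.inv_lt_of_transGen {σ : Equiv.Perm (Fin n)} (hσ : Admissible c σ)
    {i j : Fin n} (h : Relation.TransGen (CanonEdge c) i j) : σ⁻¹ i < σ⁻¹ j := by
  induction h with
  | single h => exact hσ.inv_lt_of_dep h.dep
  | tail _ h ih => exact ih.trans (hσ.inv_lt_of_dep h.dep)

/-- Two gates of an admissible reordering are either related in the canonical form, or can be
interchanged without touching any gate outside the window that they span. -/
theorem Admissible.transGen_or_interchange {σ : Equiv.Perm (Fin n)} (hσ : Admissible c σ)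
    {p q : Fin n} (hpq : p < q) :
    Relation.TransGen (CanonEdge c) (σ p) (σ q) ∨
      ∃ τ : Equiv.Perm (Fin n), Admissible c τ ∧ (∀ r, r < p ∨ q < r → τ r = σ r) ∧
        τ⁻¹ (σ q) < τ⁻¹ (σ p) := by
  induction hd : (q : ℕ) - p using Nat.strong_induction_on generalizing σ p q with
  | _ d ih =>
  subst hd
  have hpq' : (p : ℕ) < q := hpq
  obtain ⟨k, hk⟩ : ∃ k : Fin n, (k : ℕ) = p + 1 := ⟨⟨p + 1, by omega⟩, rfl⟩
  have hpk : p < k := by rw [Fin.lt_def]; omega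
  by_cases hcomm : Commute (c (σ p)) (c (σ k))
  · have hswap : Admissible c (σ * Equiv.swap p k) := hσ.tail ⟨p, k, hk, rfl, hcomm⟩
    have hout : ∀ r, r < p ∨ q < r → (σ * Equiv.swap p k) r = σ r := by
      intro r hr
      rw [Equiv.Perm.mul_apply, Equiv.swap_apply_of_ne_of_ne] <;>
        simp only [Fin.lt_def, ne_eq, Fin.ext_iff] at * <;> omega
    by_cases hkq : k = q
    · subst hkq
      exact Or.inr ⟨_, hswap, hout, by simpa using hpk⟩
    · have hkq' : (k : ℕ) < q := by
        rw [Fin.ext_iff] at hkq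
        omega
      have hq : (σ * Equiv.swap p k) q = σ q := by
        rw [Equiv.Perm.mul_apply, Equiv.swap_apply_of_ne_of_ne hpq.ne' (Ne.symm hkq)]
      have hp : (σ * Equiv.swap p k) k = σ p := by simp
      rcases ih (q - k) (by omega) hswap hkq' rfl with h | ⟨τ, hτ, hτout, hlt⟩
      · rw [hp, hq] at h
        exact Or.inl h
      · rw [hp, hq] at hlt
        refine Or.inr ⟨τ, hτ, fun r hr => ?_, hlt⟩
        rw [hτout r (hr.imp_left fun h => h.trans hpk), hout r hr]
  · have hedge : CanonEdge c (σ p) (σ k) := ⟨hcomm, σ, hσ, by simpa using hk⟩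
    by_cases hkq : k = q
    · subst hkq
      exact Or.inl (.single hedge)
    · have hkq' : (k : ℕ) < q := by
        rw [Fin.ext_iff] at hkq
        omega
      rcases ih (q - k) (by omega) hσ hkq' rfl with h | ⟨τ, hτ, hτout, hlt⟩
      · exact Or.inl (.head hedge h)
      · obtain ⟨q', hq'⟩ := τ.surjective (σ q)
        obtain ⟨k', hk'⟩ := τ.surjective (σ k)
        rw [← hq', ← hk', Equiv.Perm.coe_inv, Equiv.symm_apply_apply,
          Equiv.symm_apply_apply] at hlt
        have hkq'' : k ≤ q' := by
          by_contra! h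
          have := σ.injective ((hτout q' (.inl h)).symm.trans hq')
          exact absurd hkq' (this ▸ h).asymm
        have hk'q : k' ≤ q := by
          by_contra! h
          have := σ.injective ((hτout k' (.inr h)).symm.trans hk')
          exact absurd hkq' (this ▸ h).asymm
        have hq'q : q' < q := hlt.trans_le hk'q
        have hp : τ p = σ p := hτout p (.inl hpk)
        have hmeasure : (q' : ℕ) - p < q - p := by
          simp only [Fin.lt_def, Fin.le_def] at *
          omega
        rw [← hq', ← hp]
        rcases ih _ hmeasure hτ (hpk.trans_le hkq'') rfl with h | ⟨υ, hυ, hυout, hυlt⟩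
        · exact Or.inl h
        · refine Or.inr ⟨υ, hυ, fun r hr => ?_, hυlt⟩
          rw [hυout r (hr.imp_right hq'q.trans), hτout r (hr.imp_left fun h => h.trans hpk)]

end Circuit

theorem interchangeable_iff_not_canon_successor {M : Type*} [Monoid M] {n : ℕ}
    (c : Fin n → M) (i j : Fin n) (hij : i < j) :
    (∃ σ : Equiv.Perm (Fin n), Admissible c σ ∧ σ⁻¹ j < σ⁻¹ i) ↔
      ¬ Relation.TransGen (CanonEdge c) i j := by
  constructor
  · rintro ⟨σ, hσ, hlt⟩ h
    exact hlt.asymm (hσ.inv_lt_of_transGen h)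
  · intro h
    have hone : Admissible c 1 := .refl
    rcases hone.transGen_or_interchange hij with h' | ⟨τ, hτ, -, hlt⟩
    · exact absurd h' h
    · exact ⟨τ, hτ, hlt⟩
end

section
/- Independence of the canonical form on pairwise gate commutations (Lemma 2.1): let σ be an admissible reordering of a circuit c : Fin n → M and let c' = c ∘ σ be the commuted circuit, keeping the original gate labels (the gate with original label i sits at position σ⁻¹ i of c'). Then the canonical forms of c and c' are the same directed graph: for all labels i j : Fin n, CanonEdge c' (σ⁻¹ i) (σ⁻¹ j) ↔ CanonEdge c i j. -/
theorem Step.symm {M : Type*} [Monoid M] {n : ℕ} {c : Fin n → M}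
    {σ σ' : Equiv.Perm (Fin n)} (h : Step c σ σ') : Step c σ' σ := by
  obtain ⟨k, k', hk, rfl, hc⟩ := h
  refine ⟨k, k', hk, ?_, ?_⟩
  · rw [mul_assoc, Equiv.swap_mul_self, mul_one]
  · simpa using hc.symm

theorem step_mul_left_iff {M : Type*} [Monoid M] {n : ℕ} (c : Fin n → M)
    (σ τ τ' : Equiv.Perm (Fin n)) : Step c (σ * τ) (σ * τ') ↔ Step (c ∘ σ) τ τ' := by
  simp only [Step, mul_assoc, mul_right_inj, Function.comp_apply, Equiv.Perm.mul_apply]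

theorem reflTransGen_step_mul_left_iff {M : Type*} [Monoid M] {n : ℕ} (c : Fin n → M)
    (σ τ τ' : Equiv.Perm (Fin n)) :
    Relation.ReflTransGen (Step c) (σ * τ) (σ * τ') ↔
      Relation.ReflTransGen (Step (c ∘ σ)) τ τ' := by
  constructor
  · intro h
    have key : Relation.ReflTransGen (Step (c ∘ σ)) (σ⁻¹ * (σ * τ)) (σ⁻¹ * (σ * τ')) :=
      h.lift (p := Step (c ∘ σ)) (σ⁻¹ * ·) fun a b hab => by
        change Step (c ∘ σ) (σ⁻¹ * a) (σ⁻¹ * b)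
        rwa [← step_mul_left_iff, mul_inv_cancel_left, mul_inv_cancel_left]
    rwa [inv_mul_cancel_left, inv_mul_cancel_left] at key
  · exact fun h => h.lift (σ * ·) fun a b hab => (step_mul_left_iff c σ a b).2 hab

theorem admissible_comp_iff {M : Type*} [Monoid M] {n : ℕ} {c : Fin n → M}
    {σ : Equiv.Perm (Fin n)} (hσ : Admissible c σ) (τ : Equiv.Perm (Fin n)) :
    Admissible (c ∘ σ) τ ↔ Admissible c (σ * τ) := by
  have hσ' : Relation.ReflTransGen (Step c) σ 1 :=
    have : Std.Symm (Step c) := ⟨fun _ _ => Step.symm⟩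
    Std.Symm.symm _ _ hσ
  rw [Admissible, ← reflTransGen_step_mul_left_iff, mul_one]
  exact ⟨hσ.trans, hσ'.trans⟩

theorem canonical_form_independent_of_commutation {M : Type*} [Monoid M] {n : ℕ}
    (c : Fin n → M) (σ : Equiv.Perm (Fin n)) (hσ : Admissible c σ)
    (i j : Fin n) :
    CanonEdge (c ∘ σ) (σ⁻¹ i) (σ⁻¹ j) ↔ CanonEdge c i j := by
  unfold CanonEdge
  refine and_congr (by simp) ?_
  refine (exists_congr fun τ => ?_).trans (Equiv.mulLeft σ).exists_congr_right
  rw [admissible_comp_iff hσ, Equiv.coe_mulLeft, mul_inv_rev, Equiv.Perm.mul_apply,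
    Equiv.Perm.mul_apply]
end

section
/- Characterization of the edges of the canonical form: for a circuit c : Fin n → M and labels i j : Fin n, CanonEdge c i j holds if and only if Dep c i j holds and there is no label k : Fin n with Relation.TransGen (Dep c) i k and Relation.TransGen (Dep c) k j; that is, the canonical edges are exactly the dependent pairs that are covering pairs of dependence reachability. -/
namespace Admissible

variable {M : Type*} [Monoid M] {n : ℕ} {c : Fin n → M}

/-- Interchanging commuting gates preserves the relative order of dependent gates. -/
theorem symm_lt_symm_of_dep {σ : Equiv.Perm (Fin n)} (h : Admissible c σ) {a b : Fin n}
    (hab : Dep c a b) : σ.symm a < σ.symm b := by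
  induction h with
  | refl => exact hab.1
  | @tail τ τ' _ hstep ih =>
    obtain ⟨k, k', hk, rfl, hc⟩ := hstep
    obtain ⟨p, rfl⟩ := τ.surjective a
    obtain ⟨q, rfl⟩ := τ.surjective b
    simp only [Equiv.symm_apply_apply] at ih
    change Equiv.swap k k' (τ.symm (τ p)) < Equiv.swap k k' (τ.symm (τ q))
    simp only [Equiv.symm_apply_apply]
    have hne : ¬ (p = k ∧ q = k') := by
      rintro ⟨rfl, rfl⟩
      exact hab.2 hc
    simp only [Equiv.swap_apply_def, Fin.lt_def, Fin.ext_iff] at *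
    split_ifs <;> omega

theorem symm_lt_symm_of_transGen_dep {σ : Equiv.Perm (Fin n)} (h : Admissible c σ) {a b : Fin n}
    (hab : Relation.TransGen (Dep c) a b) : σ.symm a < σ.symm b := by
  induction hab with
  | single hd => exact h.symm_lt_symm_of_dep hd
  | tail _ hd ih => exact ih.trans (h.symm_lt_symm_of_dep hd)

end Admissible

/-- A permutation without adjacent descents is the identity. -/
theorem Equiv.Perm.exists_descent_of_ne_one {n : ℕ} {σ : Equiv.Perm (Fin n)} (hσ : σ ≠ 1) :
    ∃ k k' : Fin n, (k' : ℕ) = (k : ℕ) + 1 ∧ σ k' < σ k := by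
  by_contra! h
  refine hσ (σ.monotone_iff.1 ?_)
  cases n with
  | zero => exact fun a => a.elim0
  | succ n => exact Fin.monotone_iff_le_succ.2 fun i => h _ _ (by simp)

/-- A reordering that keeps dependent gates in order is admissible. -/
theorem admissible_of_symm_lt_symm {M : Type*} [Monoid M] {n : ℕ} {c : Fin n → M}
    (σ : Equiv.Perm (Fin n)) (h : ∀ a b, Dep c a b → σ.symm a < σ.symm b) :
    Admissible c σ := by
  have wf : WellFounded fun τ τ' : Equiv.Perm (Fin n) => toLex ⇑τ < toLex ⇑τ' :=
    InvImage.wf (fun τ : Equiv.Perm (Fin n) => toLex ⇑τ) (Finite.to_wellFoundedLT).wf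
  induction σ using wf.induction with
  | h σ ih =>
    by_cases hσ : σ = 1
    · exact hσ ▸ Relation.ReflTransGen.refl
    obtain ⟨k, k', hk, hlt⟩ := Equiv.Perm.exists_descent_of_ne_one hσ
    have hkk : k < k' := by rw [Fin.lt_def]; omega
    have hcomm : Commute (c (σ k')) (c (σ k)) := by
      by_contra hc
      have := h _ _ ⟨hlt, hc⟩
      simp only [Equiv.symm_apply_apply] at this
      exact hkk.not_gt this
    refine (ih (σ * Equiv.swap k k') ⟨k, fun p hp => ?_, ?_⟩ fun a b hab => ?_).tail
      ⟨k, k', hk, ?_, ?_⟩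
    · simp [Equiv.swap_apply_of_ne_of_ne hp.ne (hp.trans hkk).ne]
    · simpa using hlt
    · have hlt' := h a b hab
      change Equiv.swap k k' (σ.symm a) < Equiv.swap k k' (σ.symm b)
      have hne : ¬ (σ.symm a = k ∧ σ.symm b = k') := by
        rintro ⟨rfl, rfl⟩
        simp only [Equiv.apply_symm_apply] at hlt
        exact hlt.not_gt hab.1
      simp only [Equiv.swap_apply_def, Fin.lt_def, Fin.ext_iff] at hlt' hne hkk ⊢
      split_ifs <;> omega
    · simp [mul_assoc]
    · simpa using hcomm

theorem lt_of_transGen_dep {M : Type*} [Monoid M] {n : ℕ} {c : Fin n → M} {a b : Fin n}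
    (h : Relation.TransGen (Dep c) a b) : a < b :=
  Admissible.symm_lt_symm_of_transGen_dep (σ := 1) Relation.ReflTransGen.refl h

/-- If the labels are sorted by a rank that is monotone along dependence, ties being broken by the
original order, the resulting reordering is admissible. -/
theorem exists_admissible_symm_lt_symm_iff {M : Type*} [Monoid M] {n : ℕ} {c : Fin n → M}
    (r : Fin n → ℕ) (hr : ∀ a b, Dep c a b → r a ≤ r b) :
    ∃ σ : Equiv.Perm (Fin n), Admissible c σ ∧
      ∀ a b, σ.symm a < σ.symm b ↔ r a < r b ∨ r a = r b ∧ a < b := by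
  let f : Fin n → ℕ ×ₗ Fin n := fun l => toLex (r l, l)
  have hf : Function.Injective f := fun a b hab => congrArg (fun x => (ofLex x).2) hab
  have hmono : StrictMono (f ∘ Tuple.sort f) :=
    (Tuple.monotone_sort f).strictMono_of_injective (hf.comp (Tuple.sort f).injective)
  have key (a b : Fin n) : (Tuple.sort f).symm a < (Tuple.sort f).symm b ↔
      r a < r b ∨ r a = r b ∧ a < b := by
    rw [← hmono.lt_iff_lt]
    simp [f, Prod.Lex.toLex_lt_toLex]
  refine ⟨Tuple.sort f, admissible_of_symm_lt_symm _ fun a b hab => (key a b).2 ?_, key⟩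
  exact (hr a b hab).lt_or_eq.imp_right fun h => ⟨h, hab.1⟩

theorem canonEdge_iff_dep_covering {M : Type*} [Monoid M] {n : ℕ}
    (c : Fin n → M) (i j : Fin n) :
    CanonEdge c i j ↔
      Dep c i j ∧ ¬ ∃ k : Fin n,
        Relation.TransGen (Dep c) i k ∧ Relation.TransGen (Dep c) k j := by
  constructor
  · rintro ⟨hc, σ, hσ, hadj⟩
    change (σ.symm j : ℕ) = (σ.symm i : ℕ) + 1 at hadj
    refine ⟨⟨?_, hc⟩, ?_⟩
    · rcases lt_trichotomy i j with h | rfl | h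
      · exact h
      · omega
      · have := Fin.lt_def.1 (hσ.symm_lt_symm_of_dep ⟨h, fun h' => hc h'.symm⟩)
        omega
    · rintro ⟨k, hik, hkj⟩
      have h₁ := Fin.lt_def.1 (hσ.symm_lt_symm_of_transGen_dep hik)
      have h₂ := Fin.lt_def.1 (hσ.symm_lt_symm_of_transGen_dep hkj)
      omega
  · rintro ⟨hij, hcov⟩
    classical
    let r : Fin n → ℕ := fun l =>
      if l = i then 1 else if l = j then 2 else if Relation.TransGen (Dep c) i l then 3 else 0
    have hr : ∀ a b, Dep c a b → r a ≤ r b := by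
      intro a b hab
      have hia : a = i ∨ a = j ∨ Relation.TransGen (Dep c) i a →
          Relation.TransGen (Dep c) i b := by
        rintro (rfl | rfl | h)
        · exact .single hab
        · exact .tail (.single hij) hab
        · exact h.tail hab
      have hbi : Relation.TransGen (Dep c) i b → b ≠ i := fun h => (lt_of_transGen_dep h).ne'
      have hbj : Relation.TransGen (Dep c) i a → b ≠ j := by
        rintro h rfl
        exact hcov ⟨a, h, .single hab⟩
      have haj : a = j → b ≠ j := by
        rintro rfl rfl
        exact hab.1.false
      grind
    obtain ⟨σ, hσ, hlt⟩ := exists_admissible_symm_lt_symm_iff r hr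
    refine ⟨hij.2, σ, hσ, ?_⟩
    change (σ.symm j : ℕ) = (σ.symm i : ℕ) + 1
    have hpos := Fin.lt_def.1 (hσ.symm_lt_symm_of_dep hij)
    by_contra hne
    obtain ⟨l, hl⟩ := σ.symm.surjective ⟨(σ.symm i : ℕ) + 1, by omega⟩
    have hil := (hlt i l).1 (by rw [hl, Fin.lt_def]; simp)
    have hlj := (hlt l j).1 (by rw [hl, Fin.lt_def]; simp only; omega)
    have hij' := hij.1.ne
    grind
end

section
/- Characterization of admissible reorderings: a permutation σ : Equiv.Perm (Fin n) is an admissible reordering of the circuit c : Fin n → M if and only if σ preserves the relative order of every pair of non-commuting gates, i.e. for all labels i j : Fin n with ¬ Commute (c i) (c j), i < j ↔ σ⁻¹ i < σ⁻¹ j. -/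
theorem Fin.swap_lt_swap_iff_of_adjacent {n : ℕ} {k k' p q : Fin n}
    (hk : (k' : ℕ) = (k : ℕ) + 1) (h₁ : ¬ (p = k ∧ q = k')) (h₂ : ¬ (p = k' ∧ q = k)) :
    Equiv.swap k k' p < Equiv.swap k k' q ↔ p < q := by
  simp only [Equiv.swap_apply_def]
  split_ifs <;> simp only [Fin.ext_iff, Fin.lt_def] at * <;> omega

theorem Equiv.Perm.eq_one_of_forall_adjacent_lt {n : ℕ} (σ : Equiv.Perm (Fin n))
    (h : ∀ k k' : Fin n, (k' : ℕ) = (k : ℕ) + 1 → σ k < σ k') : σ = 1 := by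
  have hmono : StrictMono σ := by
    cases n with
    | zero => exact fun a => a.elim0
    | succ m => exact Fin.strictMono_iff_lt_succ.2 fun i => h _ _ (by simp)
  have hid : (σ : Fin n → Fin n) = id :=
    (hmono.range_inj strictMono_id).1 (by simp)
  exact Equiv.ext (congrFun hid)

/-- Interchanging two adjacent commuting gates keeps the order of non-commuting gates. -/
theorem preserves_order_mul_swap {M : Type*} [Monoid M] {n : ℕ} {c : Fin n → M}
    {σ : Equiv.Perm (Fin n)} {k k' : Fin n} (hk : (k' : ℕ) = (k : ℕ) + 1)
    (hc : Commute (c (σ k)) (c (σ k')))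
    (h : ∀ i j : Fin n, ¬ Commute (c i) (c j) → (i < j ↔ σ⁻¹ i < σ⁻¹ j))
    (i j : Fin n) (hij : ¬ Commute (c i) (c j)) :
    i < j ↔ (σ * Equiv.swap k k')⁻¹ i < (σ * Equiv.swap k k')⁻¹ j := by
  rw [h i j hij, mul_inv_rev, Equiv.swap_inv, Equiv.Perm.mul_apply, Equiv.Perm.mul_apply,
    Fin.swap_lt_swap_iff_of_adjacent hk]
  · rintro ⟨hi, hj⟩
    rw [Equiv.Perm.inv_eq_iff_eq] at hi hj
    exact hij (hi ▸ hj ▸ hc)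
  · rintro ⟨hi, hj⟩
    rw [Equiv.Perm.inv_eq_iff_eq] at hi hj
    exact hij (hi ▸ hj ▸ hc.symm)

theorem Admissible.preserves_order {M : Type*} [Monoid M] {n : ℕ} {c : Fin n → M}
    {σ : Equiv.Perm (Fin n)} (h : Admissible c σ) :
    ∀ i j : Fin n, ¬ Commute (c i) (c j) → (i < j ↔ σ⁻¹ i < σ⁻¹ j) := by
  induction h with
  | refl => simp
  | tail _ hstep ih =>
    obtain ⟨k, k', hk, rfl, hc⟩ := hstep
    exact preserves_order_mul_swap hk hc ih

/-- Removing an adjacent descent makes a permutation lexicographically smaller. -/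
theorem toLex_mul_swap_lt {n : ℕ} {σ : Equiv.Perm (Fin n)} {k k' : Fin n}
    (hk : (k' : ℕ) = (k : ℕ) + 1) (hσ : σ k' < σ k) :
    toLex (⇑(σ * Equiv.swap k k')) < toLex (⇑σ) := by
  refine ⟨k, fun p (hp : p < k) => ?_, by simpa using hσ⟩
  have hp' : p ≠ k' := by
    rintro rfl
    rw [Fin.lt_def] at hp
    omega
  simp [Equiv.swap_apply_of_ne_of_ne hp.ne hp']

theorem admissible_of_preserves_order {M : Type*} [Monoid M] {n : ℕ} {c : Fin n → M}
    (σ : Equiv.Perm (Fin n))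
    (h : ∀ i j : Fin n, ¬ Commute (c i) (c j) → (i < j ↔ σ⁻¹ i < σ⁻¹ j)) :
    Admissible c σ := by
  induction σ using
    (InvImage.wf (fun σ : Equiv.Perm (Fin n) => toLex (⇑σ)) wellFounded_lt).induction with
  | _ σ ih =>
  by_cases hσ : ∀ k k' : Fin n, (k' : ℕ) = (k : ℕ) + 1 → σ k < σ k'
  · rw [σ.eq_one_of_forall_adjacent_lt hσ]
    exact Relation.ReflTransGen.refl
  · push Not at hσ
    obtain ⟨k, k', hk, hle⟩ := hσ
    have hkk' : k < k' := by
      rw [Fin.lt_def]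
      omega
    have hlt : σ k' < σ k := hle.lt_of_ne (σ.injective.ne hkk'.ne')
    have hc : Commute (c (σ k)) (c (σ k')) := by
      by_contra hnc
      exact hlt.not_gt ((h _ _ hnc).2 (by simpa using hkk'))
    refine (ih _ (toLex_mul_swap_lt hk hlt) (preserves_order_mul_swap hk hc h)).tail
      ⟨k, k', hk, ?_, ?_⟩
    · simp [mul_assoc]
    · simpa using hc.symm

theorem admissible_iff_preserves_noncommuting_order {M : Type*} [Monoid M] {n : ℕ}
    (c : Fin n → M) (σ : Equiv.Perm (Fin n)) :
    Admissible c σ ↔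
      ∀ i j : Fin n, ¬ Commute (c i) (c j) → (i < j ↔ σ⁻¹ i < σ⁻¹ j) := by
  exact ⟨Admissible.preserves_order, admissible_of_preserves_order σ⟩
end

section
/- Characterization of connected parts via the canonical form: a finite set S : Finset (Fin n) of gate labels is a connected part of the circuit c : Fin n → M if and only if S is closed under dependence paths between its elements: for all labels i j k : Fin n, if i ∈ S, j ∈ S, Relation.TransGen (Dep c) i k and Relation.TransGen (Dep c) k j, then k ∈ S. -/
/-- S is a connected part of the circuit c: after some admissible reordering,
the gates of S occupy a contiguous block of positions. -/
def ConnectedPart {M : Type*} [Monoid M] {n : ℕ} (c : Fin n → M)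
    (S : Finset (Fin n)) : Prop :=
  ∃ (σ : Equiv.Perm (Fin n)) (a : ℕ), Admissible c σ ∧
    ∀ p : Fin n, σ p ∈ S ↔ (a ≤ (p : ℕ) ∧ (p : ℕ) < a + S.card)

theorem Admissible.symm_lt_of_dep {M : Type*} [Monoid M] {n : ℕ} {c : Fin n → M}
    {σ : Equiv.Perm (Fin n)} (hσ : Admissible c σ) {i j : Fin n} (hij : Dep c i j) :
    σ.symm i < σ.symm j := by
  induction hσ with
  | refl => exact hij.1
  | @tail σ τ _ hstep ih =>
    obtain ⟨k, k', hk, rfl, hcomm⟩ := hstep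
    have key : ∀ x, (σ * Equiv.swap k k').symm x = Equiv.swap k k' (σ.symm x) := fun x => rfl
    have hne : ¬ (σ.symm i = k ∧ σ.symm j = k') := by
      rintro ⟨rfl, rfl⟩
      simp only [Equiv.apply_symm_apply] at hcomm
      exact hij.2 hcomm
    rw [key, key]
    simp only [Equiv.swap_apply_def]
    grind

/-- A permutation without adjacent descents is the identity. -/
theorem Equiv.Perm.eq_one_of_adjacent_lt {n : ℕ} {σ : Equiv.Perm (Fin n)}
    (h : ∀ k k' : Fin n, (k' : ℕ) = k + 1 → σ k < σ k') : σ = 1 := by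
  cases n with
  | zero => exact Subsingleton.elim _ _
  | succ n =>
    exact σ.monotone_iff.1 (Fin.strictMono_iff_lt_succ.2 fun i => h _ _ (by simp)).monotone

theorem admissible_of_symm_lt_of_dep {M : Type*} [Monoid M] {n : ℕ} {c : Fin n → M}
    {σ : Equiv.Perm (Fin n)} (hσ : ∀ i j, Dep c i j → σ.symm i < σ.symm j) :
    Admissible c σ := by
  induction hs : toLex (σ : Fin n → Fin n) using
    (Finite.wellFounded_of_trans_of_irrefl
      ((· < ·) : Lex (Fin n → Fin n) → Lex (Fin n → Fin n) → Prop)).induction generalizing σ with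
  | h s ih =>
  subst hs
  by_cases hone : σ = 1
  · subst hone
    exact Relation.ReflTransGen.refl
  obtain ⟨k, k', hk, hle⟩ : ∃ k k' : Fin n, (k' : ℕ) = k + 1 ∧ σ k' ≤ σ k := by
    contrapose! hone
    exact Equiv.Perm.eq_one_of_adjacent_lt hone
  have hlt : k < k' := Fin.lt_def.2 (by omega)
  have hdesc : σ k' < σ k := lt_of_le_of_ne hle fun e => hlt.ne' (σ.injective e)
  have hcomm : Commute (c (σ k')) (c (σ k)) := by
    by_contra hnc
    have := hσ _ _ ⟨hdesc, hnc⟩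
    simp only [Equiv.symm_apply_apply] at this
    exact absurd this hlt.not_gt
  refine Relation.ReflTransGen.tail (b := σ * Equiv.swap k k') (ih _ ?_ ?_ rfl)
    ⟨k, k', hk, ?_, ?_⟩
  · refine ⟨k, fun j hj => ?_, ?_⟩
    · simp [Equiv.swap_apply_of_ne_of_ne hj.ne (hj.trans hlt).ne]
    · simpa using hdesc
  · intro i j hij
    have key : ∀ x, (σ * Equiv.swap k k').symm x = Equiv.swap k k' (σ.symm x) := fun x => rfl
    have hne : ¬ (σ.symm i = k ∧ σ.symm j = k') := by
      rintro ⟨rfl, rfl⟩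
      simp only [Equiv.apply_symm_apply] at hdesc
      exact hij.1.not_gt hdesc
    have := hσ i j hij
    rw [key, key]
    simp only [Equiv.swap_apply_def]
    grind
  · simp [mul_assoc]
  · simpa using hcomm

/-- A set of labels occupying an initial segment of the positions occupies exactly the first
positions, as many as it has elements. -/
theorem Equiv.Perm.apply_mem_iff_lt_card {n : ℕ} {σ : Equiv.Perm (Fin n)} {T : Finset (Fin n)}
    (hT : ∀ p q, p ≤ q → σ q ∈ T → σ p ∈ T) (p : Fin n) : σ p ∈ T ↔ (p : ℕ) < T.card := by
  have hcard : (T.map σ.symm.toEmbedding).card = T.card := Finset.card_map _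
  have hmem : ∀ q, q ∈ T.map σ.symm.toEmbedding ↔ σ q ∈ T := fun q => by
    simp [Finset.mem_map_equiv]
  rw [← hcard]
  constructor
  · intro hp
    have hsub : Finset.Iic p ⊆ T.map σ.symm.toEmbedding := fun q hq =>
      (hmem q).2 (hT q p (Finset.mem_Iic.1 hq) hp)
    have := Finset.card_le_card hsub
    rw [Fin.card_Iic] at this
    omega
  · intro hp
    by_contra hnot
    have hsub : T.map σ.symm.toEmbedding ⊆ Finset.Iio p := fun q hq => by
      rw [Finset.mem_Iio]
      by_contra hpq
      exact hnot (hT p q (not_lt.1 hpq) ((hmem q).1 hq))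
    have := Finset.card_le_card hsub
    rw [Fin.card_Iio] at this
    omega

/-- If the dependence relation is monotone for a grading of the labels, then sorting the labels
stably by their grade is an admissible reordering. -/
theorem exists_admissible_monotone {M : Type*} [Monoid M] {n : ℕ} {c : Fin n → M}
    {f : Fin n → ℕ} (hf : ∀ i j, Dep c i j → f i ≤ f j) :
    ∃ σ : Equiv.Perm (Fin n), Admissible c σ ∧ Monotone (f ∘ σ) := by
  let g : Fin n → ℕ ×ₗ Fin n := fun i => toLex (f i, i)
  have hg : Monotone (g ∘ Tuple.sort g) := Tuple.monotone_sort g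
  refine ⟨Tuple.sort g, admissible_of_symm_lt_of_dep fun i j hij => ?_, fun p q hpq => ?_⟩
  · by_contra hle
    have h := hg (not_lt.1 hle)
    simp only [Function.comp_apply, Equiv.apply_symm_apply, g, Prod.Lex.toLex_le_toLex] at h
    have := hf i j hij
    have := hij.1
    grind
  · have h := hg hpq
    simp only [Function.comp_apply, g, Prod.Lex.toLex_le_toLex] at h ⊢
    grind

theorem connectedPart_iff_dep_path_closed {M : Type*} [Monoid M] {n : ℕ}
    (c : Fin n → M) (S : Finset (Fin n)) :
    ConnectedPart c S ↔
      ∀ i j k : Fin n, i ∈ S → j ∈ S →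
        Relation.TransGen (Dep c) i k → Relation.TransGen (Dep c) k j → k ∈ S := by
  constructor
  · rintro ⟨σ, a, hσ, hS⟩ i j k hi hj hik hkj
    have hpath : ∀ {x y}, Relation.TransGen (Dep c) x y → σ.symm x < σ.symm y := fun h =>
      Relation.TransGen.trans_induction_on h hσ.symm_lt_of_dep fun _ _ => lt_trans
    have mem_iff : ∀ x, x ∈ S ↔ a ≤ (σ.symm x : ℕ) ∧ (σ.symm x : ℕ) < a + S.card := fun x => by
      simpa using hS (σ.symm x)
    rw [mem_iff] at hi hj ⊢
    have := Fin.lt_def.1 (hpath hik)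
    have := Fin.lt_def.1 (hpath hkj)
    omega
  · intro hS
    classical
    let A : Finset (Fin n) :=
      Finset.univ.filter fun k => k ∉ S ∧ ∃ s ∈ S, Relation.TransGen (Dep c) k s
    have memA : ∀ k, k ∈ A ↔ k ∉ S ∧ ∃ s ∈ S, Relation.TransGen (Dep c) k s := fun k => by
      simp [A]
    let f : Fin n → ℕ := fun k => if k ∈ A then 0 else if k ∈ S then 1 else 2
    have hf : ∀ i j, Dep c i j → f i ≤ f j := by
      intro i j hij
      have hA : j ∈ A → i ∈ A := fun hj => by
        obtain ⟨hjS, s, hs, hjs⟩ := (memA j).1 hj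
        exact (memA i).2 ⟨fun hi => hjS (hS i s j hi hs (.single hij) hjs), s, hs, .head hij hjs⟩
      have hAS : j ∈ S → i ∈ A ∨ i ∈ S := fun hj => by
        by_cases hi : i ∈ S
        · exact .inr hi
        · exact .inl ((memA i).2 ⟨hi, j, hj, .single hij⟩)
      grind
    obtain ⟨σ, hσ, hmono⟩ := exists_admissible_monotone hf
    have hdisj : Disjoint A S :=
      Finset.disjoint_left.2 fun k hk => ((memA k).1 hk).1
    have hlow := Equiv.Perm.apply_mem_iff_lt_card (σ := σ) (T := A) fun p q hpq hq => by
      have : f (σ p) ≤ f (σ q) := hmono hpq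
      grind
    have hupp := Equiv.Perm.apply_mem_iff_lt_card (σ := σ) (T := A ∪ S) fun p q hpq hq => by
      have : f (σ p) ≤ f (σ q) := hmono hpq
      grind
    refine ⟨σ, A.card, hσ, fun p => ?_⟩
    rw [← Finset.card_union_of_disjoint hdisj, ← hupp, ← not_lt, ← hlow, Finset.mem_union]
    have : σ p ∈ A → σ p ∉ S := fun h => Finset.disjoint_left.1 hdisj h
    tauto
end

section
/- Forward–backward decomposition of a circuit at a starting gate: for every circuit c : Fin n → M and every label r : Fin n there is an admissible reordering σ of c such that for every label j : Fin n, σ⁻¹ r ≤ σ⁻¹ j ↔ (j = r ∨ Relation.TransGen (Dep c) r j). In other words, C ≃ (C^backward, C^forward): the forward part, consisting of the starting gate r together with all its dependence successors, occupies the final positions with r first among them, and the backward part, consisting of all gates that can be commuted to the left of the starting gate, occupies the initial positions. -/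
theorem Fin.swap_lt_swap_of_lt {n : ℕ} {k k' p q : Fin n} (hk : (k' : ℕ) = (k : ℕ) + 1)
    (hpq : p < q) (h : ¬ (p = k ∧ q = k')) : Equiv.swap k k' p < Equiv.swap k k' q := by
  simp only [Equiv.swap_apply_def, Fin.lt_def, Fin.ext_iff] at *
  split_ifs <;> omega

/-- A set of labels closed under dependence can be moved to the end of the circuit, keeping its
internal order. -/
theorem exists_admissible_of_dep_closed {M : Type*} [Monoid M] {n : ℕ} (c : Fin n → M)
    (F : Fin n → Prop) (hF : ∀ i j, Dep c i j → F i → F j) :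
    ∃ σ : Equiv.Perm (Fin n), Admissible c σ ∧
      (∀ p q, p < q → F (σ p) → σ p < σ q) ∧ (∀ p q, p ≤ q → F (σ p) → F (σ q)) := by
  classical
  let S : Set (Equiv.Perm (Fin n)) :=
    {σ | Admissible c σ ∧ ∀ p q, p < q → F (σ p) → σ p < σ q}
  let weight (σ : Equiv.Perm (Fin n)) : ℕ := ∑ j, if F j then ((σ⁻¹ j : Fin n) : ℕ) else 0
  have hone : (1 : Equiv.Perm (Fin n)) ∈ S := ⟨Relation.ReflTransGen.refl, fun p q h _ => h⟩
  obtain ⟨σ, ⟨hadm, hord⟩, hmax⟩ := Set.exists_max_image S weight S.toFinite ⟨1, hone⟩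
  have hadj : ∀ k k' : Fin n, (k' : ℕ) = (k : ℕ) + 1 → F (σ k) → F (σ k') := by
    intro k k' hk hFk
    by_contra hFk'
    have hlt : k < k' := by rw [Fin.lt_def]; omega
    have hcomm : Commute (c (σ k)) (c (σ k')) := by
      by_contra hc
      exact hFk' (hF _ _ ⟨hord k k' hlt hFk, hc⟩ hFk)
    have hmem : σ * Equiv.swap k k' ∈ S := by
      refine ⟨hadm.tail ⟨k, k', hk, rfl, hcomm⟩, fun p q hpq hFp => ?_⟩
      refine hord _ _ (Fin.swap_lt_swap_of_lt hk hpq ?_) hFp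
      rintro ⟨rfl, rfl⟩
      exact hFk' (by simpa using hFp)
    refine (hmax _ hmem).not_gt (Finset.sum_lt_sum (fun j _ => ?_) ⟨σ k, Finset.mem_univ _, ?_⟩)
    · split_ifs with hj
      · have hne : σ⁻¹ j ≠ k' := by
          rintro rfl
          exact hFk' (by simpa using hj)
        rw [mul_inv_rev, Equiv.swap_inv, Equiv.Perm.mul_apply, Equiv.swap_apply_def]
        split_ifs with h
        · rw [h]; omega
        · exact le_rfl
      · exact le_rfl
    · simp [hFk, hk]
  refine ⟨σ, hadm, hord, fun p q hpq hFp => ?_⟩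
  obtain ⟨q, hq⟩ := q
  induction q with
  | zero =>
    have : p = ⟨0, hq⟩ := Fin.ext (by simpa [Fin.le_def] using hpq)
    exact this ▸ hFp
  | succ m ih =>
    rcases hpq.eq_or_lt with h | h
    · exact h ▸ hFp
    · exact hadj ⟨m, by omega⟩ _ rfl (ih (by omega) (by rw [Fin.lt_def] at h; exact Nat.lt_succ_iff.mp h))

theorem forward_backward_decomposition {M : Type*} [Monoid M] {n : ℕ}
    (c : Fin n → M) (r : Fin n) :
    ∃ σ : Equiv.Perm (Fin n), Admissible c σ ∧
      ∀ j : Fin n, σ⁻¹ r ≤ σ⁻¹ j ↔ (j = r ∨ Relation.TransGen (Dep c) r j) := by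
  obtain ⟨σ, hadm, hord, hup⟩ := exists_admissible_of_dep_closed c
    (Relation.ReflTransGen (Dep c) r) (fun i j hij hi => hi.tail hij)
  refine ⟨σ, hadm, fun j => ?_⟩
  rw [← Relation.reflTransGen_iff_eq_or_transGen]
  refine ⟨fun h => ?_, fun h => ?_⟩
  · simpa using hup _ _ h (by simpa using Relation.ReflTransGen.refl)
  · by_contra hlt
    have hjr : j < r := by simpa using hord _ _ (not_le.mp hlt) (by simpa using h)
    have hrj : r ≤ j := by
      clear hlt hjr
      induction h with
      | refl => exact le_rfl
      | tail _ hij ih => exact ih.trans hij.1.le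
    exact hrj.not_gt hjr
end

section
/- Dependence-downward-closed sets of gates can be commuted to the front of a circuit: if S : Finset (Fin n) satisfies that for all labels i j : Fin n, Relation.TransGen (Dep c) i j and j ∈ S imply i ∈ S, then there is an admissible reordering σ of the circuit c : Fin n → M such that S occupies exactly the first S.card positions: for every position p : Fin n, σ p ∈ S ↔ (p : ℕ) < S.card. -/
/-- A subset of `Fin n` that contains the predecessor of each of its elements is an initial
segment, hence consists of the elements below its cardinality. -/
theorem Fin.mem_iff_lt_card_of_pred_closed {n : ℕ} (T : Finset (Fin n))
    (hT : ∀ k k' : Fin n, (k' : ℕ) = (k : ℕ) + 1 → k' ∈ T → k ∈ T) (p : Fin n) :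
    p ∈ T ↔ (p : ℕ) < T.card := by
  have lower : ∀ d : ℕ, ∀ a b : Fin n, (b : ℕ) = (a : ℕ) + d → b ∈ T → a ∈ T := by
    intro d
    induction d with
    | zero =>
      intro a b hab hb
      rwa [show a = b from Fin.ext hab.symm]
    | succ d ih =>
      intro a b hab hb
      have hlt : (a : ℕ) + d < n := by have := b.isLt; omega
      exact ih a ⟨a + d, hlt⟩ rfl (hT _ b hab hb)
  constructor
  · intro hp
    have hsub : Finset.Iic p ⊆ T := fun a ha => by
      have hle : a ≤ p := Finset.mem_Iic.mp ha
      exact lower (p - a) a p (by have := Fin.le_def.mp hle; omega) hp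
    have := Finset.card_le_card hsub
    rw [Fin.card_Iic] at this
    omega
  · intro hlt
    by_contra hp
    have hsub : T ⊆ Finset.Iio p := fun b hb => by
      rw [Finset.mem_Iio]
      by_contra hbp
      have hle : (p : ℕ) ≤ b := not_lt.mp hbp
      exact hp (lower (b - p) p b (by omega) hb)
    have := Finset.card_le_card hsub
    rw [Fin.card_Iio] at this
    omega

theorem Fin.le_swap_of_ne {n : ℕ} {k k' a : Fin n} (hk : k ≤ k') (ha : a ≠ k') :
    a ≤ Equiv.swap k k' a := by
  rw [Equiv.swap_apply_def]
  split_ifs with h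
  · exact h ▸ hk
  · exact le_rfl

theorem Fin.swap_le_of_ne {n : ℕ} {k k' a : Fin n} (hk : k ≤ k') (ha : a ≠ k) :
    Equiv.swap k k' a ≤ a := by
  rw [Equiv.swap_apply_def, if_neg ha]
  split_ifs with h
  · exact h ▸ hk
  · exact le_rfl

/-- If gates outside `S` precede gates of `S` only in their original order, then the gates of `S`
can be moved to the front. -/
theorem Admissible.exists_front {M : Type*} [Monoid M] {n : ℕ} {c : Fin n → M}
    {S : Finset (Fin n)} (hS : ∀ i j : Fin n, Dep c i j → j ∈ S → i ∈ S)
    (σ : Equiv.Perm (Fin n)) (hσ : Admissible c σ)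
    (hord : ∀ i j : Fin n, i ∉ S → j ∈ S → σ.symm i < σ.symm j → i < j) :
    ∃ τ : Equiv.Perm (Fin n), Admissible c τ ∧
      ∀ p : Fin n, τ p ∈ S ↔ (p : ℕ) < S.card := by
  induction hm : ∑ i ∈ S, (σ.symm i : ℕ) using Nat.strong_induction_on generalizing σ with
  | _ m ih =>
  by_cases hadj : ∀ k k' : Fin n, (k' : ℕ) = (k : ℕ) + 1 → σ k' ∈ S → σ k ∈ S
  · refine ⟨σ, hσ, fun p => ?_⟩
    have h := Fin.mem_iff_lt_card_of_pred_closed (S.map σ.symm.toEmbedding)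
      (by simpa [Finset.mem_map_equiv] using hadj) p
    simpa [Finset.mem_map_equiv] using h
  · push Not at hadj
    obtain ⟨k, k', hkk, hk', hk⟩ := hadj
    have hlt : k < k' := Fin.lt_def.mpr (by omega)
    have hcomm : Commute (c (σ k)) (c (σ k')) := by
      by_contra hc
      exact hk (hS _ _ ⟨hord _ _ hk hk' (by simpa using hlt), hc⟩ hk')
    have hneS : ∀ j ∈ S, σ.symm j ≠ k := by
      rintro j hj rfl
      exact hk (by simpa using hj)
    have hneC : ∀ i ∉ S, σ.symm i ≠ k' := by
      rintro i hi rfl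
      exact hi (by simpa using hk')
    have hsymm : ∀ i, (σ * Equiv.swap k k').symm i = Equiv.swap k k' (σ.symm i) :=
      fun _ => rfl
    refine ih _ ?_ (σ * Equiv.swap k k') (hσ.tail ⟨k, k', hkk, rfl, hcomm⟩) ?_ rfl
    · rw [← hm]
      simp only [hsymm]
      refine Finset.sum_lt_sum (fun j hj => Fin.swap_le_of_ne hlt.le (hneS j hj))
        ⟨σ k', hk', ?_⟩
      simpa using hlt
    · intro i j hi hj hij
      rw [hsymm, hsymm] at hij
      exact hord i j hi hj <| (Fin.le_swap_of_ne hlt.le (hneC i hi)).trans_lt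
        (hij.trans_le (Fin.swap_le_of_ne hlt.le (hneS j hj)))

theorem downward_closed_commutes_to_front {M : Type*} [Monoid M] {n : ℕ}
    (c : Fin n → M) (S : Finset (Fin n))
    (hS : ∀ i j : Fin n, Relation.TransGen (Dep c) i j → j ∈ S → i ∈ S) :
    ∃ σ : Equiv.Perm (Fin n), Admissible c σ ∧
      ∀ p : Fin n, σ p ∈ S ↔ (p : ℕ) < S.card :=
  Admissible.exists_front (fun i j hij => hS i j (.single hij)) 1 .refl
    fun _ _ _ _ hij => hij
end

section
/- A pattern match preserves the successor relation between matched gates: for a match of length ℓ of a pattern t : Fin m → M in a circuit c : Fin n → M, given by admissible reorderings σ of t and τ of c and offsets a b as in the definition, and for all p q < ℓ, Relation.TransGen (Dep t) (σ ⟨a + p⟩) (σ ⟨a + q⟩) ↔ Relation.TransGen (Dep c) (τ ⟨b + p⟩) (τ ⟨b + q⟩). In particular, if one matched pattern gate is a dependence successor of another, then the circuit gates they are matched with stand in the same successor relation. -/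
/-- An admissible reordering keeps the relative order of any two non-commuting gates. -/
theorem Admissible.lt_iff_lt {M : Type*} [Monoid M] {n : ℕ} {c : Fin n → M}
    {σ : Equiv.Perm (Fin n)} (hσ : Admissible c σ) {i j : Fin n}
    (hij : ¬ Commute (c (σ i)) (c (σ j))) : σ i < σ j ↔ i < j := by
  unfold Admissible at hσ
  induction hσ generalizing i j with
  | refl => rfl
  | @tail σ σ' _ hstep ih =>
    obtain ⟨k, k', hk, rfl, hcomm⟩ := hstep
    simp only [Equiv.Perm.mul_apply] at hij ⊢
    rw [ih hij]
    have hcomm' := hcomm.symm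
    simp only [Equiv.swap_apply_def] at hij ⊢
    split_ifs at hij ⊢ <;> simp_all only [Fin.lt_def, Fin.ext_iff] <;> omega

/-- Dependences between the gates of an admissible reordering point from left to right. -/
theorem Admissible.dep_iff {M : Type*} [Monoid M] {n : ℕ} {c : Fin n → M}
    {σ : Equiv.Perm (Fin n)} (hσ : Admissible c σ) {i j : Fin n} :
    Dep c (σ i) (σ j) ↔ i < j ∧ ¬ Commute (c (σ i)) (c (σ j)) :=
  and_congr_left fun hij => hσ.lt_iff_lt hij

/-- Successors of a gate stand to its right in every admissible reordering. -/
theorem Admissible.symm_lt_symm_of_transGen {M : Type*} [Monoid M] {n : ℕ} {c : Fin n → M}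
    {σ : Equiv.Perm (Fin n)} (hσ : Admissible c σ) {x y : Fin n}
    (h : Relation.TransGen (Dep c) x y) : σ.symm x < σ.symm y := by
  have key : ∀ {x y : Fin n}, Dep c x y → σ.symm x < σ.symm y := fun {x y} hxy =>
    (hσ.dep_iff.1 (by simpa using hxy : Dep c (σ (σ.symm x)) (σ (σ.symm y)))).1
  induction h with
  | single h => exact key h
  | tail _ h ih => exact ih.trans (key h)

/-- A match carries successors among the matched pattern gates to successors in the circuit. -/
theorem Admissible.transGen_dep_of_match {M : Type*} [Monoid M] {m n : ℕ}
    {t : Fin m → M} {c : Fin n → M} {ℓ a b : ℕ}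
    {σ : Equiv.Perm (Fin m)} {τ : Equiv.Perm (Fin n)}
    (hσ : Admissible t σ) (hτ : Admissible c τ)
    (ha : a + ℓ ≤ m) (hb : b + ℓ ≤ n)
    (hmatch : ∀ p : Fin ℓ, t (σ ((p.natAdd a).castLE ha)) = c (τ ((p.natAdd b).castLE hb)))
    {p q : Fin ℓ}
    (h : Relation.TransGen (Dep t) (σ ((p.natAdd a).castLE ha)) (σ ((q.natAdd a).castLE ha))) :
    Relation.TransGen (Dep c) (τ ((p.natAdd b).castLE hb)) (τ ((q.natAdd b).castLE hb)) := by
  have key : ∀ r s : Fin ℓ,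
      Dep t (σ ((r.natAdd a).castLE ha)) (σ ((s.natAdd a).castLE ha)) →
        Dep c (τ ((r.natAdd b).castLE hb)) (τ ((s.natAdd b).castLE hb)) := by
    intro r s hrs
    rw [hσ.dep_iff, hmatch r, hmatch s] at hrs
    refine hτ.dep_iff.2 ⟨?_, hrs.2⟩
    simpa only [Fin.lt_def, Fin.val_castLE, Fin.val_natAdd, Nat.add_lt_add_iff_left] using hrs.1
  generalize hy : σ ((q.natAdd a).castLE ha) = y at h
  induction h generalizing q with
  | single h => exact .single (key p q (hy ▸ h))
  | @tail z y hxz hzy ih =>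
    subst hy
    have hlt := hσ.symm_lt_symm_of_transGen hxz
    have hlt' := hσ.symm_lt_symm_of_transGen (.single hzy)
    simp only [Equiv.symm_apply_apply, Fin.lt_def, Fin.val_castLE, Fin.val_natAdd] at hlt hlt'
    obtain ⟨r, rfl⟩ : ∃ r : Fin ℓ, σ ((r.natAdd a).castLE ha) = z := by
      refine ⟨⟨(σ.symm z : ℕ) - a, by omega⟩, ?_⟩
      rw [← Equiv.eq_symm_apply, Fin.ext_iff]
      simp only [Fin.val_castLE, Fin.val_natAdd]
      omega
    exact (ih rfl).tail (key r q hzy)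

theorem match_preserves_successor_relation {M : Type*} [Monoid M] {m n : ℕ}
    (t : Fin m → M) (c : Fin n → M) (ℓ a b : ℕ)
    (σ : Equiv.Perm (Fin m)) (τ : Equiv.Perm (Fin n))
    (hσ : Admissible t σ) (hτ : Admissible c τ)
    (ha : a + ℓ ≤ m) (hb : b + ℓ ≤ n)
    (hmatch : ∀ p : ℕ, (hp : p < ℓ) →
      t (σ ⟨a + p, by omega⟩) = c (τ ⟨b + p, by omega⟩))
    (p q : ℕ) (hp : p < ℓ) (hq : q < ℓ) :
    Relation.TransGen (Dep t) (σ ⟨a + p, by omega⟩) (σ ⟨a + q, by omega⟩) ↔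
      Relation.TransGen (Dep c) (τ ⟨b + p, by omega⟩) (τ ⟨b + q, by omega⟩) := by
  exact ⟨hσ.transGen_dep_of_match hτ ha hb (fun r => hmatch r r.2) (p := ⟨p, hp⟩) (q := ⟨q, hq⟩),
    hτ.transGen_dep_of_match hσ hb ha (fun r => (hmatch r r.2).symm)
      (p := ⟨p, hp⟩) (q := ⟨q, hq⟩)⟩
end

section
/- The canonical form of a circuit is a directed acyclic graph: for a circuit c : Fin n → M and labels i j : Fin n, CanonEdge c i j implies i < j; in particular the reachability relation Relation.TransGen (CanonEdge c) is irreflexive, so the canonical form contains no directed cycles. -/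
theorem Admissible.lt_of_not_commute {M : Type*} [Monoid M] {n : ℕ} {c : Fin n → M}
    {σ : Equiv.Perm (Fin n)} (hσ : Admissible c σ) :
    ∀ p q : Fin n, p < q → ¬ Commute (c (σ p)) (c (σ q)) → σ p < σ q := by
  induction hσ with
  | refl => exact fun p q h _ => h
  | tail _ hstep ih =>
    obtain ⟨k, k', hk, rfl, hcomm⟩ := hstep
    intro p q hpq hnc
    simp only [Equiv.Perm.mul_apply] at hnc ⊢
    refine ih _ _ ?_ hnc
    by_cases hkk : p = k ∧ q = k'
    · obtain ⟨rfl, rfl⟩ := hkk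
      rw [Equiv.swap_apply_left, Equiv.swap_apply_right] at hnc
      exact absurd hcomm.symm hnc
    · simp only [Equiv.swap_apply_def]
      split_ifs <;> simp only [Fin.ext_iff, Fin.lt_def] at * <;> omega

theorem CanonEdge.lt {M : Type*} [Monoid M] {n : ℕ} {c : Fin n → M} {i j : Fin n}
    (h : CanonEdge c i j) : i < j := by
  obtain ⟨hnc, σ, hσ, hpos⟩ := h
  have hlt : σ⁻¹ i < σ⁻¹ j := by
    rw [Fin.lt_def]
    omega
  simpa using hσ.lt_of_not_commute _ _ hlt (by simpa using hnc)

theorem canonical_form_is_dag {M : Type*} [Monoid M] {n : ℕ} (c : Fin n → M) :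
    (∀ i j : Fin n, CanonEdge c i j → i < j) ∧
      Irreflexive (Relation.TransGen (CanonEdge c)) := by
  refine ⟨fun i j h => h.lt, fun i hi => ?_⟩
  have hlt : ∀ {a b : Fin n}, Relation.TransGen (CanonEdge c) a b → a < b := by
    intro a b hab
    induction hab with
    | single h => exact h.lt
    | tail _ h ih => exact ih.trans h.lt
  exact lt_irrefl i (hlt hi)
end

section
/- Equivalence of circuits under pairwise commutation is an equivalence relation: if σ is an admissible reordering of the circuit c : Fin n → M, then σ⁻¹ is an admissible reordering of the commuted circuit c ∘ σ; and if moreover τ is an admissible reordering of c ∘ σ, then σ * τ is an admissible reordering of c (where (σ * τ) p = σ (τ p), so that (c ∘ σ) ∘ τ = c ∘ (σ * τ)). -/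
theorem step_comp_iff {M : Type*} [Monoid M] {n : ℕ} {c : Fin n → M}
    {σ τ τ' : Equiv.Perm (Fin n)} :
    Step (c ∘ σ) τ τ' ↔ Step c (σ * τ) (σ * τ') := by
  simp [Step, mul_assoc]

theorem admissible_symm_trans {M : Type*} [Monoid M] {n : ℕ}
    (c : Fin n → M) (σ : Equiv.Perm (Fin n)) (hσ : Admissible c σ) :
    Admissible (c ∘ σ) σ⁻¹ ∧
      ∀ τ : Equiv.Perm (Fin n), Admissible (c ∘ σ) τ → Admissible c (σ * τ) := by
  refine ⟨?_, fun τ hτ => ?_⟩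
  · have : Std.Symm (Step c) := ⟨fun _ _ => Step.symm⟩
    have h : Relation.ReflTransGen (Step c) σ 1 := symm hσ
    simpa [Admissible, Function.onFun] using Relation.ReflTransGen.lift (p := Step (c ∘ σ))
      (σ⁻¹ * ·) (fun a b hab => step_comp_iff.2 (by simpa using hab)) _ _ h
  · have h := Relation.ReflTransGen.lift (p := Step c) (σ * ·)
      (fun _ _ => step_comp_iff.1) _ _ hτ
    exact Relation.ReflTransGen.trans hσ (by simpa [Function.onFun] using h)
end
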